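/- Every tempered distribution on ℝ^n is a finite sum of weakly homogeneous tempered distributions: for every continuous ℂ-linear functional u on 𝓢(ℝ^n, ℂ) there exist N ∈ ℕ, real numbers a₁, …, a_N, and tempered distributions u₁, …, u_N on ℝ^n such that u = u₁ + ⋯ + u_N and each u_i is weakly homogeneous of degree a_i, i.e. for every Schwartz φ there exists C > 0 with |u_i(φ_s)| ≤ C·s^{a_i} for all s > 0, where φ_s(x) = φ(s⁻¹x). -/

import Mathlib

/-- A tempered distribution `w` on `ℝ^n` is weakly homogeneous of degree `a` (`w ∈ E^a`) if for
every Schwartz `φ` there is `C > 0` with `|w(φ_s)| ≤ C s^a` for all `s > 0`, where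
`φ_s(x) = φ(s⁻¹x)`. -/
def WeaklyHomogeneous (n : ℕ) (w : SchwartzMap (Fin n → ℝ) ℂ →L[ℂ] ℂ) (a : ℝ) : Prop :=
  ∀ φ : SchwartzMap (Fin n → ℝ) ℂ, ∃ C : ℝ, 0 < C ∧
    ∀ s : ℝ, 0 < s → ∀ φs : SchwartzMap (Fin n → ℝ) ℂ,
      (∀ x, φs x = φ (s⁻¹ • x)) → ‖w φs‖ ≤ C * s ^ a

open scoped ContDiff

section Symmetry
variable {E F : Type*} [NormedAddCommGroup E] [NormedSpace ℝ E]
  [NormedAddCommGroup F] [NormedSpace ℝ F]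

theorem ContDiff.differentiable_iteratedFDeriv_of_infty {f : E → F} (hf : ContDiff ℝ ∞ f) (m : ℕ) :
    Differentiable ℝ (iteratedFDeriv ℝ m f) :=
  hf.differentiable_iteratedFDeriv (by exact_mod_cast WithTop.coe_lt_top m)

theorem ContDiff.iteratedFDeriv_two_of_infty {f : E → F} (hf : ContDiff ℝ ∞ f) (m : ℕ) :
    ContDiff ℝ 2 (iteratedFDeriv ℝ m f) :=
  hf.iteratedFDeriv_right (by
    have h : ∀ k : ℕ, (k : WithTop ℕ∞) ≤ ∞ := fun k ↦ mod_cast le_top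
    simpa using h (2 + m))

theorem iteratedFDeriv_comp_swap_castSucc_succ {f : E → F} (hf : ContDiff ℝ ∞ f) {m : ℕ}
    (i : Fin m) (x : E) (v : Fin (m + 1) → E) :
    iteratedFDeriv ℝ (m + 1) f x (v ∘ Equiv.swap i.castSucc i.succ) =
      iteratedFDeriv ℝ (m + 1) f x v := by
  induction m generalizing x with
  | zero => exact i.elim0
  | succ m ih =>
    induction i using Fin.cases with
    | zero =>
      have key : ∀ w : Fin (m + 2) → E, iteratedFDeriv ℝ (m + 2) f x w =
          fderiv ℝ (fderiv ℝ (iteratedFDeriv ℝ m f)) x (w 0) (w 1) (Fin.tail (Fin.tail w)) := by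
        intro w
        rw [(hf.differentiable_iteratedFDeriv_of_infty (m + 1) x).iteratedFDeriv_succ_apply_left']
        have h2 : (fun y ↦ iteratedFDeriv ℝ (m + 1) f y (Fin.tail w)) =
            fun y ↦ fderiv ℝ (iteratedFDeriv ℝ m f) y (w 1) (Fin.tail (Fin.tail w)) := by
          funext y
          exact iteratedFDeriv_succ_apply_left _
        have hd : DifferentiableAt ℝ (fderiv ℝ (iteratedFDeriv ℝ m f)) x :=
          ((hf.iteratedFDeriv_two_of_infty m).fderiv_right (m := 1) (by norm_num)).differentiable
            (by norm_num) x
        rw [h2, fderiv_continuousMultilinear_apply_const_apply (hd.clm_apply (by fun_prop)),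
          fderiv_clm_apply hd (by fun_prop)]
        simp
      have hs : IsSymmSndFDerivAt ℝ (iteratedFDeriv ℝ m f) x :=
        (hf.iteratedFDeriv_two_of_infty m).contDiffAt.isSymmSndFDerivAt (by simp)
      rw [key, key]
      have ht : Fin.tail (Fin.tail (v ∘ Equiv.swap (Fin.castSucc 0) (Fin.succ 0))) =
          Fin.tail (Fin.tail v) := by
        funext j
        simp only [Fin.tail, Function.comp]
        rw [Equiv.swap_apply_of_ne_of_ne]
        · simp [Fin.ext_iff]
        · simp [Fin.ext_iff]
      rw [ht]
      have h0 : (v ∘ Equiv.swap (Fin.castSucc (0 : Fin (m + 1))) (Fin.succ 0)) 0 = v 1 := by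
        simp
      have h1 : (v ∘ Equiv.swap (Fin.castSucc (0 : Fin (m + 1))) (Fin.succ 0)) 1 = v 0 := by
        simp
      rw [h0, h1, hs.eq]
    | succ i =>
      have hd := hf.differentiable_iteratedFDeriv_of_infty (m + 1) x
      rw [hd.iteratedFDeriv_succ_apply_left', hd.iteratedFDeriv_succ_apply_left']
      have ht : Fin.tail (v ∘ Equiv.swap i.succ.castSucc i.succ.succ) =
          Fin.tail v ∘ Equiv.swap i.castSucc i.succ := by
        funext j
        simp only [Fin.tail, Function.comp]
        rw [← Fin.succ_castSucc, ← (Fin.succ_injective _).map_swap]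
      have h0 : (v ∘ Equiv.swap i.succ.castSucc i.succ.succ) 0 = v 0 := by
        simp only [Function.comp]
        rw [Equiv.swap_apply_of_ne_of_ne]
        · simp [Fin.ext_iff]
        · simp [Fin.ext_iff]
      rw [ht, h0]
      simp_rw [ih]

theorem ContDiff.iteratedFDeriv_comp_perm_of_infty {f : E → F} (hf : ContDiff ℝ ∞ f) {m : ℕ}
    (x : E) (v : Fin m → E) (σ : Equiv.Perm (Fin m)) :
    iteratedFDeriv ℝ m f x (v ∘ σ) = iteratedFDeriv ℝ m f x v := by
  cases m with
  | zero => congr 1; exact Subsingleton.elim _ _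
  | succ m =>
    have hσ : σ ∈ Submonoid.closure
        (Set.range fun i : Fin m ↦ Equiv.swap i.castSucc i.succ) := by
      rw [Equiv.Perm.mclosure_swap_castSucc_succ]; trivial
    induction hσ using Submonoid.closure_induction generalizing v with
    | mem τ hτ =>
      obtain ⟨i, rfl⟩ := hτ
      exact iteratedFDeriv_comp_swap_castSucc_succ hf i x v
    | one => rfl
    | mul τ ρ _ _ hτ hρ =>
      rw [Equiv.Perm.coe_mul, ← Function.comp_assoc, hρ, hτ]

/-- The homogeneous term of degree `j` in the Taylor expansion of `f` at the origin. -/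
noncomputable def taylorTerm (f : E → F) (j : ℕ) (x : E) : F :=
  (j.factorial : ℝ)⁻¹ • iteratedFDeriv ℝ j f 0 fun _ ↦ x

theorem contDiff_taylorTerm (f : E → F) (j : ℕ) : ContDiff ℝ ∞ (taylorTerm f j) := by
  refine ContDiff.const_smul _ ?_
  exact (ContinuousMultilinearMap.contDiff (iteratedFDeriv ℝ j f 0)).comp (by fun_prop)

theorem iteratedFDeriv_sum_taylorTerm [CompleteSpace F] {f : E → F} (hf : ContDiff ℝ ∞ f)
    {K i : ℕ} (hi : i < K) :
    iteratedFDeriv ℝ i (fun x ↦ ∑ j ∈ Finset.range K, taylorTerm f j x) 0 =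
      iteratedFDeriv ℝ i f 0 := by
  let p : FormalMultilinearSeries ℝ E F := fun j ↦
    if j < K then (j.factorial : ℝ)⁻¹ • iteratedFDeriv ℝ j f 0 else 0
  have hp : HasFiniteFPowerSeriesOnBall
      (fun x ↦ ∑ j ∈ Finset.range K, taylorTerm f j x) p 0 K ⊤ := by
    refine .mk' (fun m hm ↦ by simp [p, hm]) (by simp) fun y _ ↦ ?_
    refine Finset.sum_congr rfl fun j hj ↦ ?_
    simp [p, Finset.mem_range.1 hj, taylorTerm]
  ext v
  rw [hp.toHasFPowerSeriesOnBall.iteratedFDeriv_eq_sum_of_completeSpace]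
  have : ∀ σ : Equiv.Perm (Fin i), p i (fun k ↦ v (σ k)) =
      (i.factorial : ℝ)⁻¹ • iteratedFDeriv ℝ i f 0 v := fun σ ↦ by
    simp only [p, hi, if_true, smul_apply]
    congr 1
    exact hf.iteratedFDeriv_comp_perm_of_infty 0 v σ
  simp_rw [this]
  rw [Finset.sum_const, Finset.card_univ, Fintype.card_perm, Fintype.card_fin,
    ← Nat.cast_smul_eq_nsmul ℝ, smul_smul, mul_inv_cancel₀ (by positivity), one_smul]

theorem exists_norm_iteratedFDeriv_le_pow [ProperSpace E] {f : E → F} (hf : ContDiff ℝ ∞ f) {K : ℕ}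
    (h0 : ∀ i < K, iteratedFDeriv ℝ i f 0 = 0) (r : ℝ) (m : ℕ) (hm : m ≤ K) :
    ∃ C, 0 ≤ C ∧ ∀ y, ‖y‖ ≤ r → ‖iteratedFDeriv ℝ (K - m) f y‖ ≤ C * ‖y‖ ^ m := by
  induction m with
  | zero =>
    obtain ⟨C, hC⟩ := (isCompact_closedBall (0 : E) r).exists_bound_of_continuousOn
      (hf.differentiable_iteratedFDeriv_of_infty (K - 0)).continuous.continuousOn
    exact ⟨max C 0, le_max_right _ _, fun y hy ↦ by
      simpa using Or.inl (hC y (by simpa using hy))⟩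
  | succ m ih =>
    obtain ⟨C, hC0, hC⟩ := ih (by omega)
    refine ⟨C, hC0, fun y hy ↦ ?_⟩
    have hd := hf.differentiable_iteratedFDeriv_of_infty (K - (m + 1))
    have := (convex_closedBall (0 : E) ‖y‖).norm_image_sub_le_of_norm_fderiv_le (𝕜 := ℝ)
      (f := iteratedFDeriv ℝ (K - (m + 1)) f) (C := C * ‖y‖ ^ m) (x := 0) (y := y)
      (fun z _ ↦ hd z) (fun z hz ↦ ?_) (by simp) (by simp)
    · rw [h0 _ (by omega)] at this
      simpa [pow_succ, mul_assoc] using this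
    · rw [norm_fderiv_iteratedFDeriv, show K - (m + 1) + 1 = K - m by omega]
      have hz' : ‖z‖ ≤ ‖y‖ := by simpa using hz
      exact (hC z (hz'.trans hy)).trans (by gcongr)
end Symmetry

section Cutoff
open SchwartzMap
variable {E : Type*} [NormedAddCommGroup E] [NormedSpace ℝ E]

theorem exists_norm_le_of_decay_le (u : SchwartzMap E ℂ →L[ℂ] ℂ) :
    ∃ (L : ℕ) (C : ℝ), 0 ≤ C ∧ ∀ (ψ : SchwartzMap E ℂ) (B : ℝ), 0 ≤ B →
      (∀ k ≤ L, ∀ i ≤ L, ∀ x, ‖x‖ ^ k * ‖iteratedFDeriv ℝ i ψ x‖ ≤ B) → ‖u ψ‖ ≤ C * B := by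
  obtain ⟨S, C, -, hC⟩ := Seminorm.bound_of_continuous (schwartz_withSeminorms ℂ E ℂ)
    ((normSeminorm ℂ ℂ).comp u.toLinearMap) (continuous_norm.comp u.continuous)
  refine ⟨S.sup fun p ↦ max p.1 p.2, C, C.2, fun ψ B hB h ↦ (hC ψ).trans ?_⟩
  refine mul_le_mul_of_nonneg_left ?_ C.2
  refine Seminorm.finset_sup_apply_le hB fun p hp ↦ ?_
  have hle := Finset.le_sup (f := fun p : ℕ × ℕ ↦ max p.1 p.2) hp
  exact SchwartzMap.seminorm_le_bound ℂ _ _ _ hB fun x ↦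
    h _ ((le_max_left _ _).trans hle) _ ((le_max_right _ _).trans hle) x

theorem exists_norm_iteratedFDeriv_mul_le (χ : SchwartzMap E ℂ) (L : ℕ) :
    ∃ A, 0 ≤ A ∧ ∀ (f : E → ℂ), ContDiff ℝ ∞ f → ∀ i ≤ L, ∀ (x : E) (B : ℝ),
      (∀ j ≤ i, ‖iteratedFDeriv ℝ j f x‖ ≤ B) →
        ‖iteratedFDeriv ℝ i (fun y ↦ χ y * f y) x‖ ≤ A * B := by
  set S := ∑ j ∈ Finset.range (L + 1), SchwartzMap.seminorm ℝ 0 j χ with hS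
  have hS0 : 0 ≤ S := Finset.sum_nonneg fun j _ ↦ apply_nonneg _ _
  refine ⟨2 ^ L * S, by positivity, fun f hf i hi x B hB ↦ ?_⟩
  have hB0 : 0 ≤ B := (norm_nonneg _).trans (hB 0 (Nat.zero_le _))
  calc
    _ ≤ ∑ j ∈ Finset.range (i + 1), (i.choose j : ℝ) * ‖iteratedFDeriv ℝ j χ x‖ *
          ‖iteratedFDeriv ℝ (i - j) f x‖ :=
        norm_iteratedFDeriv_mul_le (χ.smooth ⊤) hf x (mod_cast le_top)
    _ ≤ ∑ j ∈ Finset.range (i + 1), (i.choose j : ℝ) * S * B := by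
        refine Finset.sum_le_sum fun j hj ↦ ?_
        have hj' := Finset.mem_range.1 hj
        gcongr
        · exact (χ.norm_iteratedFDeriv_le_seminorm ℝ j x).trans
            (Finset.single_le_sum (f := fun j ↦ SchwartzMap.seminorm ℝ 0 j χ)
              (fun j _ ↦ apply_nonneg _ _) (Finset.mem_range.2 (by omega)))
        · exact hB _ (Nat.sub_le _ _)
    _ = 2 ^ i * S * B := by
        rw [← Finset.sum_mul, ← Finset.sum_mul]
        congr 2
        exact_mod_cast Nat.sum_range_choose i
    _ ≤ 2 ^ L * S * B := by gcongr; norm_num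

theorem exists_norm_mul_le_of_tsupport_subset (u : SchwartzMap E ℂ →L[ℂ] ℂ)
    (χ : SchwartzMap E ℂ) (hχ : tsupport χ ⊆ Metric.closedBall 0 2) :
    ∃ (L : ℕ) (C : ℝ), 0 ≤ C ∧ ∀ (f : E → ℂ), ContDiff ℝ ∞ f → ∀ B, 0 ≤ B →
      (∀ i ≤ L, ∀ x, ‖x‖ ≤ 2 → ‖iteratedFDeriv ℝ i f x‖ ≤ B) →
        ∀ ψ : SchwartzMap E ℂ, (∀ x, ψ x = χ x * f x) → ‖u ψ‖ ≤ C * B := by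
  obtain ⟨L, C, hC0, hC⟩ := exists_norm_le_of_decay_le u
  obtain ⟨A, hA0, hA⟩ := exists_norm_iteratedFDeriv_mul_le χ L
  refine ⟨L, C * (2 ^ L * A), by positivity, fun f hf B hB h ψ hψ ↦ ?_⟩
  rw [mul_assoc]
  refine hC ψ _ (by positivity) fun k hk i hi x ↦ ?_
  have hψ' : (ψ : E → ℂ) = fun x ↦ χ x * f x := funext hψ
  by_cases hx : ‖x‖ ≤ 2
  · have h1 : ‖x‖ ^ k ≤ 2 ^ L := (pow_le_pow_left₀ (norm_nonneg _) hx k).trans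
      (pow_le_pow_right₀ (by norm_num) hk)
    rw [hψ', mul_assoc]
    exact mul_le_mul h1 (hA f hf i hi x B fun j hj ↦ h j (hj.trans hi) x hx) (norm_nonneg _)
      (by positivity)
  · have : x ∉ tsupport (iteratedFDeriv ℝ i ψ) := fun hx' ↦ by
      have h2 := (tsupport_iteratedFDeriv_subset i).trans
        ((by rw [hψ']; exact tsupport_mul_subset_left : tsupport ψ ⊆ tsupport χ).trans hχ) hx'
      exact hx (by simpa using h2)
    rw [image_eq_zero_of_notMem_tsupport this, norm_zero, mul_zero]
    positivity

/-- The product of a compactly supported Schwartz function and a smooth function. -/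
noncomputable def cutoff (χ : SchwartzMap E ℂ) (hχ : HasCompactSupport χ) (f : E → ℂ)
    (hf : ContDiff ℝ ∞ f) : SchwartzMap E ℂ :=
  (hχ.mul_right : HasCompactSupport fun x ↦ χ x * f x).toSchwartzMap ((χ.smooth ⊤).mul hf)

theorem cutoff_apply (χ : SchwartzMap E ℂ) (hχ : HasCompactSupport χ) (f : E → ℂ)
    (hf : ContDiff ℝ ∞ f) (x : E) : cutoff χ hχ f hf x = χ x * f x :=
  rfl

theorem norm_iteratedFDeriv_taylorTerm_le (f : E → ℂ) (i j : ℕ) (x : E) :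
    ‖iteratedFDeriv ℝ i (taylorTerm f j) x‖ ≤
      j.descFactorial i * ‖x‖ ^ (j - i) * ‖iteratedFDeriv ℝ j f 0‖ := by
  set M := (j.factorial : ℝ)⁻¹ • iteratedFDeriv ℝ j f 0 with hM
  let δ : E →L[ℝ] (Fin j → E) := ContinuousLinearMap.pi fun _ ↦ ContinuousLinearMap.id ℝ E
  have hδ : ∀ y, ‖δ y‖ ≤ ‖y‖ := fun y ↦ (pi_norm_le_iff_of_nonneg (norm_nonneg y)).2 fun _ ↦ le_rfl
  have hδ1 : ‖δ‖ ≤ 1 := ContinuousLinearMap.opNorm_le_bound _ zero_le_one (by simpa using hδ)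
  have hMn : ‖M‖ ≤ ‖iteratedFDeriv ℝ j f 0‖ := by
    rw [hM, norm_smul]
    refine mul_le_of_le_one_left (norm_nonneg _) ?_
    rw [norm_inv, Real.norm_natCast]
    exact inv_le_one_of_one_le₀ (mod_cast j.factorial_pos)
  have heq : taylorTerm f j = M ∘ δ := rfl
  rw [heq, δ.iteratedFDeriv_comp_right (M.contDiff (n := ∞)) x (mod_cast le_top)]
  refine (ContinuousMultilinearMap.norm_compContinuousLinearMap_le _ _).trans ?_
  have h1 : ∏ _k : Fin i, ‖δ‖ ≤ 1 := Finset.prod_le_one (fun _ _ ↦ norm_nonneg _) fun _ _ ↦ hδ1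
  refine (mul_le_of_le_one_right (norm_nonneg _) h1).trans ?_
  refine (M.norm_iteratedFDeriv_le i (δ x)).trans ?_
  rw [Fintype.card_fin, mul_right_comm]
  gcongr
  exact hδ x

/-- The distribution supported at the origin sending `φ` to the value of `u` on the cut-off of the
homogeneous term of degree `j` in the Taylor expansion of `φ`. -/
noncomputable def taylorFunctional (u : SchwartzMap E ℂ →L[ℂ] ℂ) (χ : SchwartzMap E ℂ)
    (hχ : HasCompactSupport χ) (hχ2 : tsupport χ ⊆ Metric.closedBall 0 2) (j : ℕ) :
    SchwartzMap E ℂ →L[ℂ] ℂ :=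
  SchwartzMap.mkCLMtoNormedSpace
    (fun φ ↦ u (cutoff χ hχ (taylorTerm φ j) (contDiff_taylorTerm φ j)))
    (fun φ ψ ↦ by
      rw [← map_add]
      congr 1
      ext x
      have h : iteratedFDeriv ℝ j (φ + ψ : SchwartzMap E ℂ) 0 = _ :=
        iteratedFDeriv_add_apply (φ.smooth j).contDiffAt (ψ.smooth j).contDiffAt
      simp only [add_apply, cutoff_apply, taylorTerm]
      rw [h]
      simp [mul_add])
    (fun a φ ↦ by
      rw [RingHom.id_apply, ← map_smul]
      congr 1
      ext x
      have h : iteratedFDeriv ℝ j (a • φ : SchwartzMap E ℂ) 0 = _ :=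
        iteratedFDeriv_const_smul_apply (φ.smooth j).contDiffAt
      simp only [smul_apply, cutoff_apply, taylorTerm]
      rw [h]
      simp
      ring)
    (by
      obtain ⟨L, C, hC0, hC⟩ := exists_norm_mul_le_of_tsupport_subset u χ hχ2
      set D : ℝ := ∑ i ∈ Finset.range (L + 1), (j.descFactorial i * 2 ^ (j - i) : ℝ) with hD
      have hD0 : 0 ≤ D := by positivity
      refine ⟨{(0, j)}, C * D, by positivity, fun φ ↦ ?_⟩
      rw [Finset.sup_singleton, mul_assoc]
      refine hC (taylorTerm φ j) (contDiff_taylorTerm φ j) _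
        (mul_nonneg hD0 (apply_nonneg _ _)) (fun i hi x hx ↦ ?_) _ (fun x ↦ rfl)
      refine (norm_iteratedFDeriv_taylorTerm_le φ i j x).trans ?_
      refine mul_le_mul ?_ (φ.norm_iteratedFDeriv_le_seminorm ℂ j 0) (norm_nonneg _) hD0
      refine le_trans ?_ (Finset.single_le_sum
        (f := fun i ↦ (j.descFactorial i * 2 ^ (j - i) : ℝ))
        (fun i _ ↦ by positivity) (Finset.mem_range.2 (Nat.lt_succ_of_le hi)))
      gcongr)

theorem taylorFunctional_apply (u : SchwartzMap E ℂ →L[ℂ] ℂ) (χ : SchwartzMap E ℂ)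
    (hχ : HasCompactSupport χ) (hχ2 : tsupport χ ⊆ Metric.closedBall 0 2) (j : ℕ)
    (φ : SchwartzMap E ℂ) : taylorFunctional u χ hχ hχ2 j φ =
      u (cutoff χ hχ (taylorTerm φ j) (contDiff_taylorTerm φ j)) :=
  rfl

theorem iteratedFDeriv_dilate {φ φt : SchwartzMap E ℂ} {t : ℝ} (h : ∀ x, φt x = φ (t • x)) (i : ℕ)
    (x : E) : iteratedFDeriv ℝ i φt x = t ^ i • iteratedFDeriv ℝ i φ (t • x) := by
  rw [show (φt : E → ℂ) = fun x ↦ φ (t • x) from funext h,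
    iteratedFDeriv_comp_const_smul t (φ.smooth i)]

theorem taylorTerm_dilate {φ φt : SchwartzMap E ℂ} {t : ℝ} (h : ∀ x, φt x = φ (t • x)) (j : ℕ)
    (x : E) : taylorTerm φt j x = t ^ j • taylorTerm φ j x := by
  simp only [taylorTerm, iteratedFDeriv_dilate h, smul_zero, smul_apply]
  rw [smul_comm]

theorem taylorTerm_smul (f : E → ℂ) (j : ℕ) (t : ℝ) (x : E) :
    taylorTerm f j (t • x) = t ^ j • taylorTerm f j x := by
  have := (iteratedFDeriv ℝ j f 0).map_smul_univ (fun _ ↦ t) (fun _ ↦ x)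
  simp only [taylorTerm, this, Finset.prod_const, Finset.card_univ, Fintype.card_fin]
  rw [smul_comm]

theorem taylorFunctional_dilate (u : SchwartzMap E ℂ →L[ℂ] ℂ) (χ : SchwartzMap E ℂ)
    (hχ : HasCompactSupport χ) (hχ2 : tsupport χ ⊆ Metric.closedBall 0 2) (j : ℕ)
    {φ φt : SchwartzMap E ℂ} {t : ℝ} (h : ∀ x, φt x = φ (t • x)) :
    taylorFunctional u χ hχ hχ2 j φt = (t : ℂ) ^ j * taylorFunctional u χ hχ hχ2 j φ := by
  rw [taylorFunctional_apply, taylorFunctional_apply, ← smul_eq_mul, ← map_smul]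
  congr 1
  ext x
  simp only [smul_apply, cutoff_apply, taylorTerm_dilate h]
  simp
  ring

/-- Subtracting enough Taylor functionals from a compactly supported distribution produces the same
power bound for small and for large dilations. -/
theorem exists_norm_sub_sum_taylorFunctional_le [ProperSpace E] (u : SchwartzMap E ℂ →L[ℂ] ℂ)
    (χ : SchwartzMap E ℂ) (hχ : HasCompactSupport χ)
    (hχ2 : tsupport χ ⊆ Metric.closedBall 0 2) :
    ∃ K : ℕ, ∀ φ : SchwartzMap E ℂ, ∃ C, ∀ t : ℝ, 0 < t → ∀ φt : SchwartzMap E ℂ,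
      (∀ x, φt x = φ (t • x)) →
        ‖(u ∘L smulLeftCLM ℂ χ - ∑ j : Fin K, taylorFunctional u χ hχ hχ2 j) φt‖ ≤ C * t ^ K := by
  obtain ⟨K, C, hC0, hC⟩ := exists_norm_mul_le_of_tsupport_subset u χ hχ2
  refine ⟨K, fun φ ↦ ?_⟩
  set R : E → ℂ := fun x ↦ φ x - ∑ j ∈ Finset.range K, taylorTerm φ j x with hR
  have hsum : ContDiff ℝ ∞ fun x ↦ ∑ j ∈ Finset.range K, taylorTerm φ j x :=
    ContDiff.sum fun j _ ↦ contDiff_taylorTerm φ j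
  have hRs : ContDiff ℝ ∞ R := (φ.smooth ⊤).sub hsum
  have hR0 : ∀ i < K, iteratedFDeriv ℝ i R 0 = 0 := fun i hi ↦ by
    have h : iteratedFDeriv ℝ i R 0 = _ := iteratedFDeriv_sub_apply
      ((φ.smooth i).contDiffAt) ((hsum.of_le (mod_cast le_top)).contDiffAt)
    rw [h, iteratedFDeriv_sum_taylorTerm (φ.smooth ⊤) hi, sub_self]
  choose! D hD0 hD using exists_norm_iteratedFDeriv_le_pow hRs hR0 2
  set P := ∑ i ∈ Finset.range (K + 1), SchwartzMap.seminorm ℝ 0 i φ with hP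
  have hP0 : 0 ≤ P := Finset.sum_nonneg fun j _ ↦ apply_nonneg _ _
  set Q := ∑ i ∈ Finset.range (K + 1), D i with hQ
  have hDm : ∀ m ∈ Finset.range (K + 1), 0 ≤ D m := fun m hm ↦
    hD0 m (Nat.lt_succ_iff.1 (Finset.mem_range.1 hm))
  have hQ0 : 0 ≤ Q := Finset.sum_nonneg hDm
  set T := ∑ j : Fin K, ‖taylorFunctional u χ hχ hχ2 j φ‖ with hT
  have hT0 : 0 ≤ T := by positivity
  refine ⟨C * P + T + C * (Q * 2 ^ K), fun t ht φt hφt ↦ ?_⟩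
  rcases le_total 1 t with h1 | h1
  · have hu : ‖(u ∘L smulLeftCLM ℂ χ) φt‖ ≤ C * (P * t ^ K) := by
      refine hC φt (φt.smooth ⊤) _ (by positivity) (fun i hi x _ ↦ ?_) _ fun x ↦
        smulLeftCLM_apply_apply χ.hasTemperateGrowth φt x
      rw [iteratedFDeriv_dilate hφt, norm_smul, norm_pow, Real.norm_of_nonneg ht.le, mul_comm]
      refine mul_le_mul ((φ.norm_iteratedFDeriv_le_seminorm ℝ i _).trans ?_)
        (pow_le_pow_right₀ h1 hi) (by positivity) hP0
      exact Finset.single_le_sum (f := fun j ↦ SchwartzMap.seminorm ℝ 0 j φ)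
        (fun j _ ↦ apply_nonneg _ _) (Finset.mem_range.2 (by omega))
    have hs : ‖∑ j : Fin K, taylorFunctional u χ hχ hχ2 j φt‖ ≤ T * t ^ K := by
      rw [hT, Finset.sum_mul]
      refine norm_sum_le_of_le _ fun j _ ↦ ?_
      rw [taylorFunctional_dilate u χ hχ hχ2 j hφt, norm_mul, norm_pow, Complex.norm_real,
        Real.norm_of_nonneg ht.le, mul_comm]
      gcongr
      exact j.2.le
    rw [sub_apply, sum_apply]
    refine (norm_sub_le _ _).trans ((add_le_add hu hs).trans ?_)
    have : 0 ≤ C * (Q * 2 ^ K) * t ^ K := by positivity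
    linarith
  · have heq : (u ∘L smulLeftCLM ℂ χ - ∑ j : Fin K, taylorFunctional u χ hχ hχ2 j) φt =
        u (smulLeftCLM ℂ χ φt - ∑ j : Fin K,
          cutoff χ hχ (taylorTerm φt j) (contDiff_taylorTerm φt j)) := by
      simp [taylorFunctional_apply]
    have hu : ‖(u ∘L smulLeftCLM ℂ χ - ∑ j : Fin K, taylorFunctional u χ hχ hχ2 j) φt‖ ≤
        C * (Q * 2 ^ K * t ^ K) := by
      rw [heq]
      refine hC (fun x ↦ R (t • x)) (hRs.comp (contDiff_const_smul t)) _ (by positivity)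
        (fun i hi x hx ↦ ?_) _ fun x ↦ ?_
      · rw [iteratedFDeriv_comp_const_smul t (hRs.of_le (mod_cast le_top)), norm_smul, norm_pow,
          Real.norm_of_nonneg ht.le]
        have htx : ‖t • x‖ = t * ‖x‖ := by rw [norm_smul, Real.norm_of_nonneg ht.le]
        have hb := hD (K - i) (Nat.sub_le _ _) (t • x)
          (htx.trans_le ((mul_le_of_le_one_left (norm_nonneg _) h1).trans hx))
        rw [Nat.sub_sub_self hi, htx, mul_pow] at hb
        have hDQ : D (K - i) ≤ Q :=
          Finset.single_le_sum hDm (Finset.mem_range.2 (by omega))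
        have hx2 : ‖x‖ ^ (K - i) ≤ 2 ^ K := (pow_le_pow_left₀ (norm_nonneg _) hx _).trans
          (pow_le_pow_right₀ (by norm_num) (Nat.sub_le _ _))
        calc
          _ ≤ t ^ i * (D (K - i) * (t ^ (K - i) * ‖x‖ ^ (K - i))) := by gcongr
          _ ≤ t ^ i * (Q * (t ^ (K - i) * 2 ^ K)) := by gcongr
          _ = Q * 2 ^ K * (t ^ i * t ^ (K - i)) := by ring
          _ = Q * 2 ^ K * t ^ K := by rw [← pow_add, Nat.add_sub_cancel' hi]
      · rw [sub_apply, smulLeftCLM_apply_apply χ.hasTemperateGrowth,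
          sum_apply]
        simp only [cutoff_apply, hR, hφt, smul_eq_mul, taylorTerm_dilate hφt, taylorTerm_smul]
        rw [mul_sub, Finset.mul_sum,
          Fin.sum_univ_eq_sum_range (fun j ↦ χ x * t ^ j • taylorTerm φ j x) K]
    refine hu.trans ?_
    have : 0 ≤ (C * P + T) * t ^ K := by positivity
    linarith

/-- A distribution vanishing near the origin satisfies the same power bound for small and for large
dilations. -/
theorem exists_norm_sub_smulLeftCLM_le (u : SchwartzMap E ℂ →L[ℂ] ℂ) (χ : SchwartzMap E ℂ)
    (hχ1 : ∀ x ∈ Metric.ball (0 : E) 1, χ x = 1) :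
    ∃ L : ℕ, ∀ φ : SchwartzMap E ℂ, ∃ C, ∀ t : ℝ, 0 < t → ∀ φt : SchwartzMap E ℂ,
      (∀ x, φt x = φ (t • x)) → ‖(u - u ∘L smulLeftCLM ℂ χ) φt‖ ≤ C * (t⁻¹) ^ L := by
  obtain ⟨L, C, hC0, hC⟩ := exists_norm_le_of_decay_le u
  obtain ⟨A, hA0, hA⟩ := exists_norm_iteratedFDeriv_mul_le χ L
  refine ⟨L, fun φ ↦ ?_⟩
  set Q := ∑ p ∈ Finset.range (2 * L + 1) ×ˢ Finset.range (L + 1),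
    SchwartzMap.seminorm ℝ p.1 p.2 φ with hQ
  have hQ0 : 0 ≤ Q := Finset.sum_nonneg fun j _ ↦ apply_nonneg _ _
  have hφ : ∀ N ≤ 2 * L, ∀ j ≤ L, ∀ x, ‖x‖ ^ N * ‖iteratedFDeriv ℝ j φ x‖ ≤ Q := by
    intro N hN j hj x
    refine (SchwartzMap.le_seminorm ℝ N j φ x).trans ?_
    exact Finset.single_le_sum (f := fun p : ℕ × ℕ ↦ SchwartzMap.seminorm ℝ p.1 p.2 φ)
      (fun j _ ↦ apply_nonneg _ _) (a := (N, j)) (by simp; omega)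
  refine ⟨C * ((1 + A) * Q), fun t ht φt hφt ↦ ?_⟩
  have hdecay : ∀ k ≤ L, ∀ j ≤ L, ∀ x, 1 ≤ ‖x‖ →
      ‖x‖ ^ k * ‖iteratedFDeriv ℝ j φt x‖ ≤ Q * (t⁻¹) ^ L := by
    intro k hk j hj x hx
    have hN : ∃ N, L ≤ N ∧ N ≤ 2 * L ∧ t ^ j ≤ t ^ N * (t⁻¹) ^ L := by
      rcases le_total 1 t with h1 | h1
      · refine ⟨2 * L, by omega, le_rfl, ?_⟩
        rw [two_mul, pow_add, mul_assoc, ← mul_pow, mul_inv_cancel₀ ht.ne', one_pow, mul_one]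
        exact pow_le_pow_right₀ h1 hj
      · refine ⟨L, le_rfl, by omega, ?_⟩
        rw [← mul_pow, mul_inv_cancel₀ ht.ne', one_pow]
        exact pow_le_one₀ ht.le h1
    obtain ⟨N, hLN, hN2, htN⟩ := hN
    rw [iteratedFDeriv_dilate hφt, norm_smul, norm_pow, Real.norm_of_nonneg ht.le]
    have hb := hφ N hN2 j hj (t • x)
    rw [norm_smul, Real.norm_of_nonneg ht.le, mul_pow] at hb
    calc
      _ ≤ ‖x‖ ^ N * (t ^ N * (t⁻¹) ^ L * ‖iteratedFDeriv ℝ j φ (t • x)‖) := by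
          gcongr
          exact hk.trans hLN
      _ = t ^ N * ‖x‖ ^ N * ‖iteratedFDeriv ℝ j φ (t • x)‖ * (t⁻¹) ^ L := by ring
      _ ≤ _ := by gcongr
  have heq : (u - u ∘L smulLeftCLM ℂ χ) φt = u (φt - smulLeftCLM ℂ χ φt) := by simp
  have hfun : ((φt - smulLeftCLM ℂ χ φt : SchwartzMap E ℂ) : E → ℂ) =
      fun x ↦ φt x - χ x * φt x := by
    ext x
    rw [sub_apply, smulLeftCLM_apply_apply χ.hasTemperateGrowth, smul_eq_mul]
  rw [heq, mul_assoc]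
  refine hC _ _ (by positivity) fun k hk i hi x ↦ ?_
  rw [hfun]
  rcases lt_or_ge ‖x‖ 1 with hx | hx
  · have hz : (fun x ↦ φt x - χ x * φt x) =ᶠ[nhds x] fun _ ↦ (0 : ℂ) := by
      filter_upwards [Metric.isOpen_ball.mem_nhds (show x ∈ Metric.ball (0 : E) 1 by simpa)]
        with y hy
      rw [hχ1 y hy, one_mul, sub_self]
    rw [(hz.iteratedFDeriv ℝ i).eq_of_nhds]
    have : iteratedFDeriv ℝ i (fun _ : E ↦ (0 : ℂ)) x = 0 := by simp
    rw [this, norm_zero, mul_zero]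
    positivity
  · have hxk : 0 < ‖x‖ ^ k := by positivity
    have h1 : ∀ j ≤ i, ‖iteratedFDeriv ℝ j φt x‖ ≤ Q * (t⁻¹) ^ L / ‖x‖ ^ k := fun j hj ↦ by
      rw [le_div_iff₀' hxk]
      exact hdecay k hk j (hj.trans hi) x hx
    have h2 := hA φt (φt.smooth ⊤) i hi x _ h1
    have h3 : iteratedFDeriv ℝ i (fun x ↦ φt x - χ x * φt x) x = _ :=
      iteratedFDeriv_sub_apply (φt.smooth i).contDiffAt
        ((χ.smooth i).mul (φt.smooth i)).contDiffAt
    rw [h3, ← le_div_iff₀' hxk]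
    refine (norm_sub_le _ _).trans ((add_le_add (h1 i le_rfl) h2).trans (le_of_eq ?_))
    ring

end Cutoff

theorem weaklyHomogeneous_of_dilate {n : ℕ} {w : SchwartzMap (Fin n → ℝ) ℂ →L[ℂ] ℂ} {a : ℝ}
    (h : ∀ φ : SchwartzMap (Fin n → ℝ) ℂ, ∃ C, ∀ t : ℝ, 0 < t → ∀ φt : SchwartzMap (Fin n → ℝ) ℂ,
      (∀ x, φt x = φ (t • x)) → ‖w φt‖ ≤ C * (t⁻¹) ^ a) : WeaklyHomogeneous n w a := by
  intro φ
  obtain ⟨C, hC⟩ := h φ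
  refine ⟨max C 1, by positivity, fun s hs φs hφs ↦ ?_⟩
  have := hC s⁻¹ (by positivity) φs hφs
  rw [inv_inv] at this
  exact this.trans (by gcongr; exact le_max_left _ _)

theorem exists_schwartzMap_bump (n : ℕ) : ∃ χ : SchwartzMap (Fin n → ℝ) ℂ,
    HasCompactSupport χ ∧ tsupport χ ⊆ Metric.closedBall 0 2 ∧
      ∀ x ∈ Metric.ball (0 : Fin n → ℝ) 1, χ x = 1 := by
  let b : ContDiffBump (0 : Fin n → ℝ) := ⟨1, 2, one_pos, one_lt_two⟩
  have hts : tsupport (fun x ↦ (b x : ℂ)) ⊆ tsupport b :=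
    closure_mono fun x hx ↦ by simpa using hx
  have hc : HasCompactSupport fun x ↦ (b x : ℂ) :=
    b.hasCompactSupport.of_isClosed_subset (isClosed_tsupport _) hts
  have hs : ContDiff ℝ ∞ fun x ↦ (b x : ℂ) := Complex.ofRealCLM.contDiff.comp b.contDiff
  refine ⟨hc.toSchwartzMap hs, hc, hts.trans b.tsupport_eq.subset, fun x hx ↦ ?_⟩
  have : b x = 1 := b.one_of_mem_closedBall (Metric.ball_subset_closedBall hx)
  simp [this]

/-- Every tempered distribution on `ℝ^n` is a finite sum of weakly homogeneous
tempered distributions. -/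
theorem stmt_18 (n : ℕ) (u : SchwartzMap (Fin n → ℝ) ℂ →L[ℂ] ℂ) :
    ∃ (N : ℕ) (a : Fin N → ℝ) (U : Fin N → (SchwartzMap (Fin n → ℝ) ℂ →L[ℂ] ℂ)),
      u = ∑ i, U i ∧ ∀ i, WeaklyHomogeneous n (U i) (a i) := by
  obtain ⟨χ, hχ, hχ2, hχ1⟩ := exists_schwartzMap_bump n
  obtain ⟨K, hK⟩ := exists_norm_sub_sum_taylorFunctional_le u χ hχ hχ2
  obtain ⟨L, hL⟩ := exists_norm_sub_smulLeftCLM_le u χ hχ1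
  let a : Option (Option (Fin K)) → ℝ
    | none => L
    | some none => -(K : ℝ)
    | some (some j) => -((j : ℕ) : ℝ)
  let U : Option (Option (Fin K)) → (SchwartzMap (Fin n → ℝ) ℂ →L[ℂ] ℂ)
    | none => u - u ∘L SchwartzMap.smulLeftCLM ℂ χ
    | some none => u ∘L SchwartzMap.smulLeftCLM ℂ χ - ∑ j : Fin K, taylorFunctional u χ hχ hχ2 j
    | some (some j) => taylorFunctional u χ hχ hχ2 j
  have hU : ∀ i, WeaklyHomogeneous n (U i) (a i)
    | none => weaklyHomogeneous_of_dilate fun φ ↦ by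
        obtain ⟨C, hC⟩ := hL φ
        exact ⟨C, fun t ht φt hφt ↦ by
          rw [Real.rpow_natCast]
          exact hC t ht φt hφt⟩
    | some none => weaklyHomogeneous_of_dilate fun φ ↦ by
        obtain ⟨C, hC⟩ := hK φ
        refine ⟨C, fun t ht φt hφt ↦ ?_⟩
        rw [Real.inv_rpow ht.le, Real.rpow_neg ht.le, inv_inv, Real.rpow_natCast]
        exact hC t ht φt hφt
    | some (some j) => weaklyHomogeneous_of_dilate fun φ ↦ by
        refine ⟨‖taylorFunctional u χ hχ hχ2 j φ‖, fun t ht φt hφt ↦ le_of_eq ?_⟩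
        rw [Real.inv_rpow ht.le, Real.rpow_neg ht.le, inv_inv, Real.rpow_natCast]
        simp only [U]
        rw [taylorFunctional_dilate u χ hχ hχ2 j hφt, norm_mul, norm_pow, Complex.norm_real,
          Real.norm_of_nonneg ht.le, mul_comm]
  let e := Fintype.equivFin (Option (Option (Fin K)))
  refine ⟨_, a ∘ e.symm, U ∘ e.symm, ?_, fun i ↦ hU (e.symm i)⟩
  rw [Function.comp_def, Equiv.sum_comp e.symm U, Fintype.sum_option, Fintype.sum_option]
  simp [U]
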